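/- (First Deformation Theorem) Under the Section 4 setup (pseudo-gradient flow φ for f on a Banach space E, index pair (N,L) with V = cl(N − L), f bounded on V, Palais–Smale in V), suppose a < b and f has no critical points in V ∩ f^{-1}([a,b]). Then there exists T ≥ 0 such that (N/L)^a ⊆ (φ_♯^T)^{-1}((N/L)^b). -/

import Mathlib

/-- The setoid on `N` collapsing the subset `L` to a single point, so that
`Quotient (collapse N L)` is the quotient space `N/L` with the quotient topology. -/
def collapse {X : Type*} (N L : Set X) : Setoid N where
  r x y := x = y ∨ ((x : X) ∈ L ∧ (y : X) ∈ L)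
  iseqv := by
    refine ⟨fun x => Or.inl rfl, ?_, ?_⟩
    · rintro x y (rfl | ⟨h1, h2⟩)
      · exact Or.inl rfl
      · exact Or.inr ⟨h2, h1⟩
    · rintro x y z (rfl | ⟨h1, h2⟩) (rfl | ⟨h3, h4⟩)
      · exact Or.inl rfl
      · exact Or.inr ⟨h3, h4⟩
      · exact Or.inr ⟨h1, h2⟩
      · exact Or.inr ⟨h1, h4⟩

/-- The set `(N/L)^a = {[L]} ∪ {π(x) : x ∈ N − L, f(x) ≥ a}` in the quotient `N/L`. -/
def lvl {E : Type*} (N L : Set E) (f : E → ℝ) (base : Quotient (collapse N L))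
    (a : ℝ) : Set (Quotient (collapse N L)) :=
  insert base {ξ | ∃ x : N, (x : E) ∈ N \ L ∧ a ≤ f (x : E) ∧
    Quotient.mk (collapse N L) x = ξ}

/-- Under the Palais–Smale condition on a closed set `V`, the derivative of `f` is bounded away
from zero on a slab `V ∩ f⁻¹([a, b])` without critical points. -/
theorem exists_pos_le_norm_fderiv_of_palaisSmale
    {E : Type*} [NormedAddCommGroup E] [NormedSpace ℝ E]
    {f : E → ℝ} (hf : ContDiff ℝ 1 f) {V : Set E} (hV : IsClosed V)
    (hPS : ∀ u : ℕ → E, (∀ n, u n ∈ V) → (∃ C, ∀ n, |f (u n)| ≤ C) →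
      Filter.Tendsto (fun n => ‖fderiv ℝ f (u n)‖) Filter.atTop (nhds 0) →
      ∃ x : E, ∃ σ : ℕ → ℕ, StrictMono σ ∧
        Filter.Tendsto (u ∘ σ) Filter.atTop (nhds x))
    {a b : ℝ} (hnc : ∀ x ∈ V, f x ∈ Set.Icc a b → fderiv ℝ f x ≠ 0) :
    ∃ δ > (0 : ℝ), ∀ x ∈ V, f x ∈ Set.Icc a b → δ ≤ ‖fderiv ℝ f x‖ := by
  by_contra! h
  choose u huV hu_mem hu_lt using fun n : ℕ => h (1 / ((n : ℝ) + 1)) (by positivity)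
  have hlim : Filter.Tendsto (fun n => ‖fderiv ℝ f (u n)‖) Filter.atTop (nhds 0) :=
    squeeze_zero (fun n => norm_nonneg _) (fun n => (hu_lt n).le)
      tendsto_one_div_add_atTop_nhds_zero_nat
  obtain ⟨x, σ, hσ, hx⟩ := hPS u huV
    ⟨max |a| |b|, fun n => abs_le_max_abs_abs (hu_mem n).1 (hu_mem n).2⟩ hlim
  have hxV : x ∈ V := hV.mem_of_tendsto hx (.of_forall fun n => huV _)
  have hxf : f x ∈ Set.Icc a b :=
    isClosed_Icc.mem_of_tendsto ((hf.continuous.tendsto x).comp hx)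
      (.of_forall fun n => hu_mem _)
  have hcont : Continuous fun y => ‖fderiv ℝ f y‖ := (hf.continuous_fderiv one_ne_zero).norm
  refine hnc x hxV hxf (norm_eq_zero.1 ?_)
  exact tendsto_nhds_unique ((hcont.tendsto x).comp hx) (hlim.comp hσ.tendsto_atTop)

/-- A differentiable monotone function that starts above `a` and grows at rate at least `c > 0`
while its values lie in `[a, b]` is above `b` at time `(b - a) / c`. -/
theorem le_apply_of_le_deriv_on_slab {g g' : ℝ → ℝ} {a b c T : ℝ} (hc : 0 < c)
    (hg : ∀ t, HasDerivAt g (g' t) t) (hg' : ∀ t, 0 ≤ g' t) (ha : a ≤ g 0)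
    (hT : T = (b - a) / c) (hT0 : 0 ≤ T)
    (hrate : ∀ t ∈ Set.Icc 0 T, g t ∈ Set.Icc a b → c ≤ g' t) : b ≤ g T := by
  by_contra! hlt
  have hmono : Monotone g :=
    monotone_of_deriv_nonneg (fun t => (hg t).differentiableAt) fun t => (hg t).deriv ▸ hg' t
  have hmv := (convex_Icc 0 T).mul_sub_le_image_sub_of_le_deriv
    (fun t _ => (hg t).continuousAt.continuousWithinAt)
    (fun t _ => (hg t).differentiableAt.differentiableWithinAt) (C := c)
    (fun t ht => by
      have ht' := interior_subset ht
      rw [(hg t).deriv]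
      exact hrate t ht' ⟨ha.trans (hmono ht'.1), (hmono ht'.2).trans hlt.le⟩)
    0 ⟨le_rfl, hT0⟩ T ⟨hT0, le_rfl⟩ hT0
  have : c * T = b - a := by rw [hT]; field_simp
  rw [sub_zero, this] at hmv
  linarith

theorem stmt14
    {E : Type*} [NormedAddCommGroup E] [NormedSpace ℝ E] [CompleteSpace E]
    (f : E → ℝ) (hf : ContDiff ℝ 1 f)
    -- α : [0,∞) → [0,∞) is strictly increasing and continuous with α(0) = 0
    (α : ℝ → ℝ) (hα1 : StrictMonoOn α (Set.Ici 0))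
    (hα2 : ContinuousOn α (Set.Ici 0)) (hα3 : α 0 = 0)
    (hα4 : ∀ r : ℝ, 0 ≤ r → 0 ≤ α r)
    -- Y is a pseudo-gradient vector field for f
    (Y : E → E) (hYb : ∃ C, ∀ x, ‖Y x‖ ≤ C)
    (hYg : ∀ x, α ‖fderiv ℝ f x‖ ≤ fderiv ℝ f x (Y x))
    (hY0 : ∀ x, fderiv ℝ f x = 0 → Y x = 0)
    -- φ is the flow of Y
    (φ : ℝ → E → E)
    (hφc : Continuous fun p : ℝ × E => φ p.1 p.2)
    (hφ0 : ∀ x, φ 0 x = x)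
    (hφadd : ∀ s t x, φ (s + t) x = φ s (φ t x))
    (hφode : ∀ x t, HasDerivAt (fun s : ℝ => φ s x) (Y (φ t x)) t)
    -- (N, L) is an index pair: closed, (i), (ii), cl(N − L) isolating
    (N L : Set E) (hN : IsClosed N) (hL : IsClosed L) (hLN : L ⊆ N)
    (hpos : ∀ x ∈ L, ∀ t ≥ (0 : ℝ), (∀ s ∈ Set.Icc 0 t, φ s x ∈ N) →
      ∀ s ∈ Set.Icc 0 t, φ s x ∈ L)
    (hexit : ∀ x ∈ N, ¬ (∀ t ≥ (0 : ℝ), φ t x ∈ N) →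
      ∃ t ≥ (0 : ℝ), (∀ s ∈ Set.Icc 0 t, φ s x ∈ N) ∧ φ t x ∈ L)
    (hiso : ∀ x ∈ closure (N \ L), (∀ t : ℝ, φ t x ∈ closure (N \ L)) →
      x ∈ interior (closure (N \ L)))
    -- f is bounded on V = cl(N − L)
    (hfb : ∃ C, ∀ x ∈ closure (N \ L), |f x| ≤ C)
    -- f satisfies the Palais–Smale condition in V
    (hPS : ∀ u : ℕ → E, (∀ n, u n ∈ closure (N \ L)) →
      (∃ C, ∀ n, |f (u n)| ≤ C) →
      Filter.Tendsto (fun n => ‖fderiv ℝ f (u n)‖) Filter.atTop (nhds 0) →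
      ∃ x : E, ∃ σ : ℕ → ℕ, StrictMono σ ∧
        Filter.Tendsto (u ∘ σ) Filter.atTop (nhds x))
    -- the point [L] in N/L and the induced semiflow φ♯ on N/L
    (l₀ : E) (hl₀ : l₀ ∈ L)
    (ψ : ℝ → Quotient (collapse N L) → Quotient (collapse N L))
    (hψ1 : ∀ t : ℝ, ∀ ht : 0 ≤ t, ∀ x : N,
      ∀ h : (∀ s ∈ Set.Icc 0 t, φ s (x : E) ∈ N \ L),
      ψ t (Quotient.mk (collapse N L) x) =
        Quotient.mk (collapse N L) ⟨φ t (x : E), (h t ⟨ht, le_rfl⟩).1⟩)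
    (hψ2 : ∀ t : ℝ, 0 ≤ t → ∀ x : N,
      ¬ (∀ s ∈ Set.Icc 0 t, φ s (x : E) ∈ N \ L) →
      ψ t (Quotient.mk (collapse N L) x) = Quotient.mk (collapse N L) ⟨l₀, hLN hl₀⟩)
    -- a < b and f has no critical points in V ∩ f⁻¹([a, b])
    (a b : ℝ) (hab : a < b)
    (hnc : ∀ x ∈ closure (N \ L), f x ∈ Set.Icc a b → fderiv ℝ f x ≠ 0) :
    ∃ T ≥ (0 : ℝ),
      lvl N L f (Quotient.mk (collapse N L) ⟨l₀, hLN hl₀⟩) a ⊆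
        (ψ T) ⁻¹' (lvl N L f (Quotient.mk (collapse N L) ⟨l₀, hLN hl₀⟩) b) := by
  obtain ⟨δ, hδ, hle⟩ := exists_pos_le_norm_fderiv_of_palaisSmale hf isClosed_closure hPS hnc
  have hαδ : 0 < α δ := hα3 ▸ hα1 Set.self_mem_Ici hδ.le hδ
  have hT0 : 0 ≤ (b - a) / α δ := div_nonneg (sub_nonneg.2 hab.le) hαδ.le
  refine ⟨(b - a) / α δ, hT0, ?_⟩
  rintro ξ (rfl | ⟨x, -, hxa, rfl⟩)
  · exact Or.inl (hψ2 _ hT0 _ fun h => (h 0 ⟨le_rfl, hT0⟩).2 (by simpa only [hφ0] using hl₀))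
  by_cases h : ∀ s ∈ Set.Icc 0 ((b - a) / α δ), φ s (x : E) ∈ N \ L
  · refine Or.inr ⟨_, h _ ⟨hT0, le_rfl⟩, ?_, (hψ1 _ hT0 x h).symm⟩
    refine le_apply_of_le_deriv_on_slab (g := fun t => f (φ t x))
      (g' := fun t => fderiv ℝ f (φ t x) (Y (φ t x))) hαδ (fun t => ?_)
      (fun t => (hα4 _ (norm_nonneg _)).trans (hYg _)) (by simpa only [hφ0] using hxa) rfl hT0
      (fun t ht hmem => ?_)
    · exact (hf.differentiable one_ne_zero _).hasFDerivAt.comp_hasDerivAt t (hφode x t)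
    · exact (hα1.monotoneOn hδ.le (norm_nonneg _) (hle _ (subset_closure (h t ht)) hmem)).trans
        (hYg _)
  · exact Or.inl (hψ2 _ hT0 x h)
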